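/- arXiv:2007.05964 — 8 statements merged into one kernel-verified Lean document; each statement's English description precedes it below -/
import Mathlib

section
/- Every cellular-compact topological space is pseudocompact: if X is a topological space such that for every family of pairwise disjoint nonempty open subsets of X there exists a compact subset of X meeting every member of the family, then every continuous function f : X → ℝ is bounded. (No separation axioms are assumed.) -/
universe u

/-- A topological space is *cellular-compact* if for every family of pairwise disjoint
nonempty open subsets there exists a compact subset meeting every member of the family. -/
def CellularCompactSpace (X : Type u) [TopologicalSpace X] : Prop :=
  ∀ 𝒰 : Set (Set X), (∀ U ∈ 𝒰, IsOpen U) → (∀ U ∈ 𝒰, U.Nonempty) →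
    𝒰.PairwiseDisjoint id →
    ∃ K : Set X, IsCompact K ∧ ∀ U ∈ 𝒰, (K ∩ U).Nonempty

/-- On a cellular-compact space, a continuous real-valued function is bounded on the union of the
preimages of the intervals `(n + c, n + c + 1)`, for `n` an integer. -/
theorem CellularCompactSpace.exists_abs_le_of_mem_Ioo {X : Type u} [TopologicalSpace X]
    (h : CellularCompactSpace X) {f : X → ℝ} (hf : Continuous f) (c : ℝ) :
    ∃ M : ℝ, ∀ (x : X) (n : ℤ), f x ∈ Set.Ioo (n + c) (n + c + 1) → |f x| ≤ M := by
  obtain ⟨K, hK, hKU⟩ := h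
    {U | U.Nonempty ∧ ∃ n : ℤ, U = f ⁻¹' Set.Ioo (n + c) (n + c + 1)}
    (by rintro _ ⟨-, n, rfl⟩; exact isOpen_Ioo.preimage hf)
    (fun U hU => hU.1)
    (by
      rintro _ ⟨-, m, rfl⟩ _ ⟨-, n, rfl⟩ hne
      refine Set.disjoint_left.2 fun x ⟨hm, hm'⟩ ⟨hn, hn'⟩ => hne ?_
      have h₁ : m < n + 1 := by
        have : (m : ℝ) < n + 1 := by linarith
        exact_mod_cast this
      have h₂ : n < m + 1 := by
        have : (n : ℝ) < m + 1 := by linarith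
        exact_mod_cast this
      obtain rfl : m = n := by omega
      rfl)
  obtain ⟨M, hM⟩ := hK.exists_bound_of_continuousOn hf.continuousOn
  refine ⟨M + 1, fun x n hx => ?_⟩
  obtain ⟨y, hyK, hy₁, hy₂⟩ := hKU _ ⟨⟨x, hx⟩, n, rfl⟩
  obtain ⟨hx₁, hx₂⟩ := hx
  have hy := abs_le.1 (hM y hyK)
  exact abs_le.2 ⟨by linarith, by linarith⟩

/-- **Every cellular-compact space is pseudocompact**: every continuous real-valued function
on a cellular-compact space is bounded.  No separation axioms are assumed. -/
theorem cellularCompact_pseudocompact {X : Type u} [TopologicalSpace X]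
    (h : CellularCompactSpace X) :
    ∀ f : X → ℝ, Continuous f → ∃ M : ℝ, ∀ x, |f x| ≤ M := by
  intro f hf
  obtain ⟨M, hM⟩ := h.exists_abs_le_of_mem_Ioo hf 0
  obtain ⟨N, hN⟩ := h.exists_abs_le_of_mem_Ioo hf (-(1 / 2))
  refine ⟨max M N, fun x => ?_⟩
  rcases (Int.floor_le (f x)).lt_or_eq with hlt | heq
  · exact (hM x ⌊f x⌋ ⟨by linarith, by linarith [Int.lt_floor_add_one (f x)]⟩).trans
      (le_max_left M N)
  · exact (hN x ⌊f x⌋ ⟨by linarith, by linarith⟩).trans (le_max_right M N)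
end

section
/- Every Ps-normal topological space is CCS-normal. That is, if X is a topological space for which there exist a normal topological space Y and a bijection f : X → Y such that f|_P : P → f(P) is a homeomorphism (with subspace topologies) for every pseudocompact subspace P of X, then there exist a normal topological space Y' and a bijection g : X → Y' such that g|_C : C → g(C) is a homeomorphism for every cellular-compact subspace C of X. -/
universe u

/-- A space `X` is *CCS-normal* if there are a normal space `Y` and a bijection `f : X → Y`
restricting to a homeomorphism `C → f '' C` on every cellular-compact subspace `C` of `X`. -/
def CCSNormal (X : Type u) [TopologicalSpace X] : Prop :=
  ∃ (Y : Type u) (tY : TopologicalSpace Y) (f : X → Y),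
    NormalSpace Y ∧ Function.Bijective f ∧
      ∀ C : Set X, CellularCompactSpace C →
        IsHomeomorph (Set.MapsTo.restrict f C (f '' C) (Set.mapsTo_image f C))
/-- A topological space is *pseudocompact* if every continuous real-valued function on it
is bounded. -/
def PseudocompactSpace (X : Type u) [TopologicalSpace X] : Prop :=
  ∀ f : X → ℝ, Continuous f → ∃ M : ℝ, ∀ x, |f x| ≤ M

/-- A space `X` is *Ps-normal* if there are a normal space `Y` and a bijection `f : X → Y`
restricting to a homeomorphism `P → f '' P` on every pseudocompact subspace `P` of `X`. -/
def PsNormal (X : Type u) [TopologicalSpace X] : Prop :=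
  ∃ (Y : Type u) (tY : TopologicalSpace Y) (f : X → Y),
    NormalSpace Y ∧ Function.Bijective f ∧
      ∀ P : Set X, PseudocompactSpace P →
        IsHomeomorph (Set.MapsTo.restrict f P (f '' P) (Set.mapsTo_image f P))

theorem CellularCompactSpace.exists_bound_of_fract_ne_zero {X : Type u} [TopologicalSpace X]
    (hX : CellularCompactSpace X) {f : X → ℝ} (hf : Continuous f) :
    ∃ M : ℝ, ∀ x, Int.fract (f x) ≠ 0 → |f x| ≤ M := by
  obtain ⟨K, hK, hmeet⟩ := hX
    {U | U.Nonempty ∧ ∃ n : ℤ, U = f ⁻¹' Set.Ioo (n : ℝ) (n + 1)}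
    (by
      rintro U ⟨-, n, rfl⟩
      exact isOpen_Ioo.preimage hf)
    (fun U hU => hU.1)
    (by
      rintro U ⟨-, n, rfl⟩ V ⟨-, m, rfl⟩ hne
      refine Set.disjoint_left.2 fun x hx hy => hne ?_
      have h₁ : n < m + 1 := by exact_mod_cast hx.1.trans hy.2
      have h₂ : m < n + 1 := by exact_mod_cast hy.1.trans hx.2
      obtain rfl : n = m := by omega
      rfl)
  obtain ⟨B, hB⟩ := hK.exists_bound_of_continuousOn hf.continuousOn
  refine ⟨B + 1, fun x hx => ?_⟩
  have hmem : x ∈ f ⁻¹' Set.Ioo (⌊f x⌋ : ℝ) (⌊f x⌋ + 1) :=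
    ⟨(Int.floor_le _).lt_of_ne fun h => hx (sub_eq_zero.2 h.symm),
      Int.lt_floor_add_one _⟩
  obtain ⟨y, hyK, hy₁, hy₂⟩ := hmeet _ ⟨⟨x, hmem⟩, _, rfl⟩
  obtain ⟨hx₁, hx₂⟩ := hmem
  have hy := abs_le.1 (hB y hyK)
  exact abs_le.2 ⟨by linarith, by linarith⟩

theorem CellularCompactSpace.pseudocompactSpace {X : Type u} [TopologicalSpace X]
    (hX : CellularCompactSpace X) : PseudocompactSpace X := by
  intro f hf
  obtain ⟨M, hM⟩ := hX.exists_bound_of_fract_ne_zero hf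
  obtain ⟨N, hN⟩ := hX.exists_bound_of_fract_ne_zero (hf.add_const (1 / 2))
  refine ⟨max M (N + 1), fun x => ?_⟩
  by_cases hx : Int.fract (f x) = 0
  · obtain ⟨n, hn⟩ := Int.fract_eq_zero_iff.1 hx
    have h : Int.fract (f x + 1 / 2) ≠ 0 := by
      rw [← hn, Int.fract_intCast_add, Int.fract_eq_self.2 (by norm_num)]
      norm_num
    have hb := abs_le.1 (hN x h)
    exact le_max_of_le_right (abs_le.2 ⟨by linarith, by linarith⟩)
  · exact le_max_of_le_left (hM x hx)

/-- **Every Ps-normal topological space is CCS-normal.** -/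
theorem psNormal_ccsNormal {X : Type u} [TopologicalSpace X] (h : PsNormal X) :
    CCSNormal X := by
  obtain ⟨Y, tY, f, hY, hf, hP⟩ := h
  exact ⟨Y, tY, f, hY, hf, fun C hC => hP C hC.pseudocompactSpace⟩
end

section
/- The real line ℝ equipped with the co-countable topology is not CCS-normal: there do not exist a normal topological space Y and a bijection f from (ℝ, co-countable topology) to Y such that f|_C : C → f(C) is a homeomorphism for every cellular-compact subspace C. -/
universe u

/-- The *co-countable topology* on a type: a set is open iff it is empty or has countable
complement. -/
def cocountableTopology (X : Type u) : TopologicalSpace X where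
  IsOpen s := s = ∅ ∨ sᶜ.Countable
  isOpen_univ := Or.inr (by simp)
  isOpen_inter s t hs ht := by
    rcases hs with rfl | hs
    · exact Or.inl (Set.empty_inter t)
    rcases ht with rfl | ht
    · exact Or.inl (Set.inter_empty s)
    · exact Or.inr (by rw [Set.compl_inter]; exact hs.union ht)
  isOpen_sUnion S hS := by
    by_cases h : ∃ t ∈ S, t ≠ ∅
    · obtain ⟨t, htS, hne⟩ := h
      rcases hS t htS with rfl | hc
      · exact absurd rfl hne
      · exact Or.inr
          (hc.mono (Set.compl_subset_compl.mpr (Set.subset_sUnion_of_mem htS)))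
    · push_neg at h
      exact Or.inl (Set.sUnion_eq_empty.mpr h)

theorem CellularCompactSpace.of_preirreducibleSpace (X : Type u) [TopologicalSpace X]
    [PreirreducibleSpace X] : CellularCompactSpace X := by
  intro 𝒰 hopen hne hdisj
  rcases 𝒰.eq_empty_or_nonempty with rfl | ⟨U, hU⟩
  · exact ⟨∅, isCompact_empty, by simp⟩
  obtain ⟨x, hx⟩ := hne U hU
  refine ⟨{x}, isCompact_singleton, fun V hV => ?_⟩
  obtain rfl : U = V := by
    by_contra hUV
    exact (nonempty_preirreducible_inter (hopen U hU) (hopen V hV) (hne U hU)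
      (hne V hV)).ne_empty (hdisj hU hV hUV).inter_eq
  exact ⟨x, rfl, hx⟩

theorem not_ccsNormal_of_preirreducibleSpace (X : Type u) [TopologicalSpace X]
    [PreirreducibleSpace X] [T1Space X] [Nontrivial X] : ¬ CCSNormal X := by
  rintro ⟨Y, tY, f, hY, hf, hC⟩
  have : PreirreducibleSpace (Set.univ : Set X) :=
    Subtype.preirreducibleSpace PreirreducibleSpace.isPreirreducible_univ
  have h := hC Set.univ (CellularCompactSpace.of_preirreducibleSpace _)
  have hcont : Continuous f :=
    (continuous_subtype_val.comp h.continuous).comp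
      (continuous_id.subtype_mk (fun x => Set.mem_univ x))
  have hrange : IsClosed (f '' Set.univ) := by
    rw [Set.image_univ, hf.surjective.range_eq]
    exact isClosed_univ
  have hclosed (x : X) : IsClosed {f x} := by
    have := hrange.isClosedMap_subtype_val.comp h.isClosedMap
      {(⟨x, Set.mem_univ x⟩ : (Set.univ : Set X))}
      isClosed_singleton
    simpa [Set.image_singleton] using this
  obtain ⟨a, b, hab⟩ := exists_pair_ne X
  obtain ⟨U, V, hU, hV, haU, hbV, hUV⟩ := normal_separation (hclosed a) (hclosed b)
    (Set.disjoint_singleton.2 (hf.injective.ne hab))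
  exact (nonempty_preirreducible_inter (hU.preimage hcont) (hV.preimage hcont)
    ⟨a, haU rfl⟩ ⟨b, hbV rfl⟩).ne_empty (hUV.preimage f).inter_eq

theorem preirreducibleSpace_cocountableTopology (X : Type u) [Uncountable X] :
    @PreirreducibleSpace X (cocountableTopology X) := by
  let := cocountableTopology X
  refine ⟨fun U V hU hV hUne hVne => ?_⟩
  rw [Set.univ_inter] at hUne hVne ⊢
  rcases hU with rfl | hU
  · exact absurd hUne Set.not_nonempty_empty
  rcases hV with rfl | hV
  · exact absurd hVne Set.not_nonempty_empty
  by_contra hempty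
  rw [Set.not_nonempty_iff_eq_empty] at hempty
  have hcount := hU.union hV
  rw [← Set.compl_inter, hempty, Set.compl_empty] at hcount
  exact Set.not_countable_univ hcount

theorem t1Space_cocountableTopology (X : Type u) : @T1Space X (cocountableTopology X) := by
  let := cocountableTopology X
  exact ⟨fun x => ⟨Or.inr (by simp)⟩⟩

/-- **`ℝ` with the co-countable topology is not CCS-normal**: there are no normal space `Y`
and bijection `f : ℝ → Y` restricting to a homeomorphism on every cellular-compact
subspace. -/
theorem cocountable_real_not_ccsNormal :
    ¬ @CCSNormal ℝ (cocountableTopology ℝ) :=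
  @not_ccsNormal_of_preirreducibleSpace ℝ (cocountableTopology ℝ)
    (preirreducibleSpace_cocountableTopology ℝ) (t1Space_cocountableTopology ℝ) _
end

section
/- Let ω₁ be the first uncountable ordinal and Ω = [0, ω₁) with the order topology. If f : Ω → Ω is a function satisfying α ≤ f(α) for every α ∈ Ω, then there exists α₀ ∈ Ω such that the point (α₀, α₀) is an accumulation point (cluster point) of the graph G(f) = {(α, f(α)) : α ∈ Ω} in the product space Ω × Ω. -/
open scoped Ordinal

/-- `Ω = [0, ω₁)`: the set of countable ordinals, with the order topology (the subspace
topology induced from the order topology on ordinals). -/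
abbrev Omega : Type 1 := ↥(Set.Iio (ω₁ : Ordinal.{0}))

/-- If `f : Ω → Ω` satisfies `α ≤ f α` for every `α`, then for some `α₀ ∈ Ω` the point
`(α₀, α₀)` is an accumulation point of the graph `{(α, f α) : α ∈ Ω}` in `Ω × Ω`. -/
theorem graph_has_diagonal_accumulation_point (f : Omega → Omega) (hf : ∀ a : Omega, a ≤ f a) :
    ∃ a₀ : Omega,
      AccPt (a₀, a₀) (Filter.principal (Set.range fun a : Omega => (a, f a))) := by
  have succ_lt (a : Omega) : Order.succ (f a : Ordinal) < ω₁ :=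
    (Cardinal.isSuccLimit_omega 1).succ_lt (f a).2
  let u : ℕ → Omega := fun n => (fun a => ⟨Order.succ (f a : Ordinal), succ_lt a⟩)^[n]
    ⟨0, Ordinal.omega_pos 1⟩
  have hu (n : ℕ) : (u (n + 1) : Ordinal) = Order.succ (f (u n) : Ordinal) := by
    simp only [u, Function.iterate_succ_apply']
  have hfu (n : ℕ) : (f (u n) : Ordinal) < u (n + 1) := by
    rw [hu]; exact Order.lt_succ _
  have hmono : StrictMono fun n => (u n : Ordinal) :=
    strictMono_nat_of_lt_succ fun n => lt_of_le_of_lt (hf (u n)) (hfu n)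
  have hbdd : BddAbove (Set.range fun n => (u n : Ordinal)) := Ordinal.bddAbove_of_small
  have hlt : ⨆ n, (u n : Ordinal) < ω₁ := Ordinal.iSup_lt_omega_one fun n => (u n).2
  have htend := tendsto_atTop_ciSup hmono.monotone hbdd
  refine ⟨⟨⨆ n, (u n : Ordinal), hlt⟩, accPt_iff_frequently.2 ?_⟩
  have hfst : Filter.Tendsto u Filter.atTop (nhds ⟨⨆ n, (u n : Ordinal), hlt⟩) :=
    tendsto_subtype_rng.2 htend
  have hsnd : Filter.Tendsto (fun n => f (u n)) Filter.atTop (nhds ⟨⨆ n, (u n : Ordinal), hlt⟩) :=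
    tendsto_subtype_rng.2 <| tendsto_of_tendsto_of_tendsto_of_le_of_le htend
      (htend.comp (Filter.tendsto_add_atTop_nat 1)) (fun n => hf (u n)) fun n => (hfu n).le
  refine (hfst.prodMk_nhds hsnd).frequently (Filter.Frequently.of_forall fun n => ⟨?_, u n, rfl⟩)
  intro h
  have h_eq : (u n : Ordinal) = ⨆ n, (u n : Ordinal) := congrArg (fun p => (p.1 : Ordinal)) h
  exact ((hmono n.lt_succ_self).trans_le (le_ciSup hbdd (n + 1))).ne h_eq
end

section
/- Let ω₁ be the first uncountable ordinal, Ω = [0, ω₁) with the order topology, Ω₀ = [0, ω₁] with the order topology, and X = Ω × Ω₀ with the product topology. Then every cellular-compact subspace A of X is contained in a compact subset of X; more precisely, the first projection p₁(A) ⊆ Ω is contained in a compact subset K of Ω, and then A ⊆ K × Ω₀, which is compact. -/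
universe u

open scoped Ordinal

/-- `Ω₀ = [0, ω₁]` with the order topology. -/
abbrev Omega0 : Type 1 := ↥(Set.Iic (ω₁ : Ordinal.{0}))

/-- The initial segments `[0, b]` of `Ω` are compact. -/
theorem isCompact_Iic_omega (b : Omega) : IsCompact (Set.Iic b) := by
  have hIcc : IsCompact (Set.Icc (0 : Ordinal.{0}) b.1) := isCompact_Icc
  rw [Subtype.isCompact_iff]
  convert hIcc using 1
  ext x
  constructor
  · rintro ⟨y, hy, rfl⟩
    exact ⟨zero_le, hy⟩
  · intro hx
    exact ⟨⟨x, hx.2.trans_lt b.2⟩, hx.2, rfl⟩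

/-- The first projection of a cellular-compact subset of `Ω × Y` is bounded. -/
theorem CellularCompactSpace.bddAbove_fst {Y : Type*} [TopologicalSpace Y]
    {A : Set (Omega × Y)} (hA : CellularCompactSpace A) : BddAbove (Prod.fst '' A) := by
  by_contra hS
  have hunb : ∀ b, ∃ s ∈ Prod.fst '' A, b < s := not_bddAbove_iff.1 hS
  have hnext : ∀ b, ∃ n ∈ Prod.fst '' A, b < n ∧ ∀ t ∈ Prod.fst '' A, b < t → n ≤ t := by
    intro b
    obtain ⟨n, ⟨hnA, hbn⟩, hmin⟩ :=
      wellFounded_lt.has_min {s | s ∈ Prod.fst '' A ∧ b < s} (hunb b)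
    exact ⟨n, hnA, hbn, fun t ht hbt => not_lt.1 (hmin t ⟨ht, hbt⟩)⟩
  choose next hnextA hlt hle using hnext
  have hfst : Continuous fun a : A => (a.1.1 : Ordinal.{0}) := by fun_prop
  have hfiber : ∀ s, {a : A | a.1.1 = next s} =
      (fun a : A => (a.1.1 : Ordinal.{0})) ⁻¹' Set.Ioo s.1 (Order.succ (next s).1) := by
    intro s
    ext a
    simp only [Set.mem_ofPred_eq, Set.mem_preimage, Set.mem_Ioo, Order.lt_succ_iff]
    constructor
    · intro h
      rw [h]
      exact ⟨hlt s, le_rfl⟩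
    · rintro ⟨h₁, h₂⟩
      exact le_antisymm h₂ (hle s _ (Set.mem_image_of_mem _ a.2) h₁)
  obtain ⟨K, hK, hmeet⟩ := hA (Set.range fun s => {a : A | a.1.1 = next s})
    (by
      rintro _ ⟨s, rfl⟩
      change IsOpen {a : A | a.1.1 = next s}
      rw [hfiber]
      exact isOpen_Ioo.preimage hfst)
    (by
      rintro _ ⟨s, rfl⟩
      obtain ⟨a, ha, has⟩ := hnextA s
      exact ⟨⟨a, ha⟩, has⟩)
    (by
      rintro _ ⟨s, rfl⟩ _ ⟨t, rfl⟩ hne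
      refine Set.disjoint_left.2 fun a has hat => hne ?_
      have hst : next s = next t := Eq.trans (Eq.symm has) hat
      simp only [hst])
  have : Nonempty Omega := ⟨⟨0, Ordinal.omega_pos 1⟩⟩
  obtain ⟨b, hb⟩ := (hK.image (continuous_fst.comp continuous_subtype_val)).bddAbove
  obtain ⟨a, haK, hab⟩ := hmeet _ ⟨b, rfl⟩
  have hab' : a.1.1 = next b := hab
  exact (hlt b).not_ge (hab' ▸ hb (Set.mem_image_of_mem _ haK))

/-- **Every cellular-compact subspace of `X = Ω × Ω₀` is contained in a compact subset**:
the first projection of such a subspace `A` is contained in a compact `K ⊆ Ω`, and then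
`A ⊆ K × Ω₀`, which is compact. -/
theorem cellularCompact_subset_of_omega_prod_contained_in_compact
    (A : Set (Omega × Omega0)) (hA : CellularCompactSpace A) :
    ∃ K : Set Omega, IsCompact K ∧ Prod.fst '' A ⊆ K ∧
      A ⊆ K ×ˢ (Set.univ : Set Omega0) ∧ IsCompact (K ×ˢ (Set.univ : Set Omega0)) := by
  obtain ⟨b, hb⟩ := hA.bddAbove_fst
  have hK : IsCompact (Set.Iic b) := isCompact_Iic_omega b
  have : CompactSpace Omega0 := by
    rw [← isCompact_iff_compactSpace, ← Set.Icc_bot]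
    exact isCompact_Icc
  exact ⟨Set.Iic b, hK, fun x hx => hb hx,
    fun a ha => ⟨hb (Set.mem_image_of_mem _ ha), Set.mem_univ _⟩, hK.prod isCompact_univ⟩
end

section
/- Let ω₁ be the first uncountable ordinal, Ω = [0, ω₁) with the order topology, Ω₀ = [0, ω₁] with the order topology, and X = Ω × Ω₀ with the product topology. Then X is CCS-normal but not Ps-normal. -/
universe u

open scoped Ordinal

/-- The type `X` with the quotient topology of the one-point compactification of `X` in which
the point at infinity is identified with `p`. -/
def OnePointCollapse {X : Type u} (_p : X) : Type u := X

namespace OnePointCollapse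

variable {X : Type u} (p : X)

/-- The quotient map sending the point at infinity to `p`. -/
def proj : OnePoint X → OnePointCollapse p := fun o => o.elim p id

theorem surjective_proj : Function.Surjective (proj p) := fun x => ⟨OnePoint.some (X := X) x, rfl⟩

/-- The identity map from `X` to its collapsed one-point compactification. -/
def mk : X → OnePointCollapse p := fun x => x

theorem bijective_mk : Function.Bijective (mk p) := Function.bijective_id

variable [TopologicalSpace X]

instance : TopologicalSpace (OnePointCollapse p) :=
  TopologicalSpace.coinduced (proj p) inferInstance

theorem continuous_proj : Continuous (proj p) := continuous_coinduced_rng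

instance : CompactSpace (OnePointCollapse p) :=
  (surjective_proj p).compactSpace (continuous_proj p)

theorem continuous_mk : Continuous (mk p) := (continuous_proj p).comp OnePoint.continuous_coe

theorem isOpen_iff {U : Set (OnePointCollapse p)} :
    IsOpen U ↔ (mk p p ∈ U → IsCompact (mk p ⁻¹' U)ᶜ) ∧ IsOpen (mk p ⁻¹' U) := by
  rw [isOpen_coinduced, OnePoint.isOpen_def]
  rfl

theorem separated_of_ne [LocallyCompactSpace X] [T2Space X] {x : X} (hx : x ≠ p) :
    ∃ U V : Set (OnePointCollapse p), IsOpen U ∧ IsOpen V ∧ mk p x ∈ U ∧ mk p p ∈ V ∧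
      Disjoint U V := by
  obtain ⟨K, hK, hxK, hKp⟩ := exists_compact_subset (isOpen_compl_singleton (x := p)) hx
  refine ⟨mk p '' interior K, mk p '' Kᶜ, ?_, ?_, Set.mem_image_of_mem _ hxK,
    Set.mem_image_of_mem _ fun h => hKp h rfl, ?_⟩
  · rw [isOpen_iff, Set.preimage_image_eq _ (bijective_mk p).1, (bijective_mk p).1.mem_set_image]
    exact ⟨fun h => (hKp (interior_subset h) rfl).elim, isOpen_interior⟩
  · rw [isOpen_iff, Set.preimage_image_eq _ (bijective_mk p).1, compl_compl]
    exact ⟨fun _ => hK, hK.isClosed.isOpen_compl⟩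
  · rw [Set.disjoint_image_iff (bijective_mk p).1]
    exact disjoint_compl_right.mono_left interior_subset

instance [LocallyCompactSpace X] [T2Space X] : T2Space (OnePointCollapse p) := by
  refine ⟨fun x y hxy => ?_⟩
  change X at x y
  by_cases hx : x = p
  · subst hx
    obtain ⟨U, V, hU, hV, hyU, hxV, hUV⟩ := separated_of_ne x (Ne.symm hxy)
    exact ⟨V, U, hV, hU, hxV, hyU, hUV.symm⟩
  by_cases hy : y = p
  · subst hy
    exact separated_of_ne y hxy
  obtain ⟨U, V, hU, hV, hxU, hyV, hUV⟩ := t2_separation (X := X) hxy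
  have key : ∀ W : Set X, IsOpen W → IsOpen (mk p '' (W \ {p})) := fun W hW => by
    rw [isOpen_iff, Set.preimage_image_eq _ (bijective_mk p).1, (bijective_mk p).1.mem_set_image]
    exact ⟨fun h => (h.2 rfl).elim, hW.sdiff isClosed_singleton⟩
  refine ⟨_, _, key U hU, key V hV, Set.mem_image_of_mem _ ⟨hxU, hx⟩,
    Set.mem_image_of_mem _ ⟨hyV, hy⟩, ?_⟩
  rw [Set.disjoint_image_iff (bijective_mk p).1]
  exact hUV.mono Set.sdiff_subset Set.sdiff_subset

end OnePointCollapse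

theorem IsCompact.isHomeomorph_restrict_of_subset {X Y : Type*} [TopologicalSpace X]
    [TopologicalSpace Y] [T2Space Y] {f : X → Y} (hf : Continuous f) (hinj : Function.Injective f)
    {K C : Set X} (hK : IsCompact K) (hCK : C ⊆ K) :
    IsHomeomorph (Set.MapsTo.restrict f C (f '' C) (Set.mapsTo_image f C)) := by
  have := isCompact_iff_compactSpace.1 hK
  have hfK : Topology.IsClosedEmbedding (fun x : K => f x) :=
    (hf.comp continuous_subtype_val).isClosedEmbedding (hinj.comp Subtype.val_injective)
  have hfC : Topology.IsEmbedding (fun x : C => f x) :=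
    hfK.isEmbedding.comp (Topology.IsEmbedding.inclusion hCK)
  rw [isHomeomorph_iff_isEmbedding_surjective]
  refine ⟨.of_comp (hf.restrict _) continuous_subtype_val hfC, ?_⟩
  rintro ⟨_, x, hx, rfl⟩
  exact ⟨⟨x, hx⟩, rfl⟩

theorem CCSNormal.of_subset_isCompact {X : Type u} [TopologicalSpace X] [LocallyCompactSpace X]
    [T2Space X] [Nonempty X]
    (h : ∀ C : Set X, CellularCompactSpace C → ∃ K, IsCompact K ∧ C ⊆ K) : CCSNormal X := by
  let p : X := Classical.arbitrary X
  refine ⟨OnePointCollapse p, inferInstance, OnePointCollapse.mk p, inferInstance,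
    OnePointCollapse.bijective_mk p, fun C hC => ?_⟩
  obtain ⟨K, hK, hCK⟩ := h C hC
  exact hK.isHomeomorph_restrict_of_subset (OnePointCollapse.continuous_mk p)
    (OnePointCollapse.bijective_mk p).1 hCK

theorem PsNormal.normalSpace {X : Type u} [TopologicalSpace X] (h : PsNormal X)
    (hX : PseudocompactSpace X) : NormalSpace X := by
  obtain ⟨Y, tY, f, hY, hf, hP⟩ := h
  have huniv : PseudocompactSpace (Set.univ : Set X) := fun g hg => by
    obtain ⟨M, hM⟩ := hX (fun x => g ⟨x, trivial⟩) (hg.comp (by fun_prop))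
    exact ⟨M, fun x => hM x⟩
  have he := (hP _ huniv).isEmbedding
  have hemb : Topology.IsEmbedding f :=
    (Topology.IsEmbedding.subtypeVal.comp he).comp (Homeomorph.Set.univ X).symm.isEmbedding
  have hcl : Topology.IsClosedEmbedding f := ⟨hemb, by rw [hf.2.range_eq]; exact isClosed_univ⟩
  exact hcl.normalSpace

namespace Omega

instance : OrderTopology Omega := orderTopology_of_ordConnected

instance : OrderTopology Omega0 := orderTopology_of_ordConnected

instance : NoMaxOrder Omega :=
  ⟨fun a => ⟨⟨Order.succ a.1, (Cardinal.isSuccLimit_omega 1).succ_lt a.2⟩, Order.lt_succ a.1⟩⟩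

instance : Nonempty Omega := ⟨⟨0, Ordinal.omega_pos 1⟩⟩

theorem isCompact_Iic (b : Omega) : IsCompact (Set.Iic b) := by
  rw [Subtype.isCompact_iff]
  have : (Subtype.val '' Set.Iic b : Set Ordinal) = Set.Icc 0 b.1 := by
    ext x
    constructor
    · rintro ⟨y, hy, rfl⟩
      exact ⟨zero_le, hy⟩
    · rintro ⟨-, hx⟩
      exact ⟨⟨x, hx.trans_lt b.2⟩, hx, rfl⟩
  rw [this]
  exact isCompact_Icc

instance : CompactSpace Omega0 := by
  rw [← isCompact_iff_compactSpace, ← Set.Icc_bot]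
  exact isCompact_Icc

instance : LocallyCompactSpace Omega := by
  have : WeaklyLocallyCompactSpace Omega := ⟨fun b => by
    obtain ⟨c, hc⟩ := exists_gt b
    exact ⟨Set.Iic c, isCompact_Iic c, Iic_mem_nhds hc⟩⟩
  infer_instance

theorem bddAbove_range {ι : Type} [Countable ι] (a : ι → Omega) : BddAbove (Set.range a) := by
  refine ⟨⟨⨆ i, (a i).1, Ordinal.iSup_lt_omega_one fun i => (a i).2⟩, ?_⟩
  rintro _ ⟨i, rfl⟩
  exact Ordinal.le_iSup (fun i => (a i).1) i

theorem exists_tendsto_of_monotone {a : ℕ → Omega} (ha : Monotone a) :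
    ∃ c, Filter.Tendsto a Filter.atTop (nhds c) := by
  obtain ⟨b, hb⟩ := bddAbove_range a
  have hne : (upperBounds (Set.range a)).Nonempty := ⟨b, hb⟩
  exact ⟨_, tendsto_atTop_isLUB ha
    ⟨wellFounded_lt.min_mem _ hne, fun x hx => not_lt.1 (wellFounded_lt.not_lt_min _ hx)⟩⟩

/-- The inclusion of `Ω` into `Ω₀`. -/
def incl (a : Omega) : Omega0 := ⟨a.1, Set.mem_Iic.2 (Set.mem_Iio.1 a.2).le⟩

theorem continuous_incl : Continuous incl := by
  unfold incl
  fun_prop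

/-- The top element of `Ω₀`. -/
noncomputable def top : Omega0 := ⟨ω₁, Set.mem_Iic.2 le_rfl⟩

theorem incl_lt_top (a : Omega) : incl a < top := Subtype.mk_lt_mk.2 a.2

theorem bddAbove_fst_image {C : Set (Omega × Omega0)} (hC : CellularCompactSpace C) :
    BddAbove (Prod.fst '' C) := by
  by_contra hb
  rw [not_bddAbove_iff] at hb
  let F : Omega → Set C := fun t => {x | x.1.1 = t}
  obtain ⟨K, hK, hKU⟩ := hC {U | IsOpen U ∧ U.Nonempty ∧ ∃ t, U = F t}
    (fun U hU => hU.1) (fun U hU => hU.2.1) (by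
      rintro _ ⟨-, -, s, rfl⟩ _ ⟨-, -, t, rfl⟩ hst
      refine Set.disjoint_left.2 fun x hxs hxt => hst ?_
      rw [show s = t from hxs.symm.trans hxt])
  have hcont : Continuous fun x : C => x.1.1 := by fun_prop
  obtain ⟨b, hbK⟩ := (hK.image hcont).bddAbove
  obtain ⟨s, hs, hbs⟩ := hb b
  have hne : {t | t ∈ Prod.fst '' C ∧ s < t}.Nonempty := hb s
  let t := wellFounded_lt.min _ hne
  obtain ⟨⟨y, hyC, hyt⟩, hst⟩ : t ∈ Prod.fst '' C ∧ s < t := wellFounded_lt.min_mem _ hne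
  obtain ⟨u, htu⟩ := exists_gt t
  have hopen : IsOpen (F t) := by
    have hgap : ∀ x : C, s < x.1.1 → t ≤ x.1.1 := fun x hx =>
      not_lt.1 (wellFounded_lt.not_lt_min {t | t ∈ Prod.fst '' C ∧ s < t}
        ⟨Set.mem_image_of_mem _ x.2, hx⟩)
    have hIic : IsOpen (Set.Iic t) := by
      have : Set.Iic t = Subtype.val ⁻¹' Set.Iio (Order.succ t.1) := by
        ext x
        exact (Order.lt_succ_iff (a := x.1) (b := t.1)).symm
      rw [this]
      exact isOpen_Iio.preimage continuous_subtype_val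
    have : F t = (fun x : C => x.1.1) ⁻¹' (Set.Ioi s ∩ Set.Iic t) := by
      ext x
      exact ⟨fun h => ⟨hst.trans_eq (Eq.symm h), le_of_eq h⟩,
        fun h => le_antisymm h.2 (hgap x h.1)⟩
    rw [this]
    exact (isOpen_Ioi.inter hIic).preimage hcont
  obtain ⟨x, hxK, hxt⟩ := hKU (F t) ⟨hopen, ⟨⟨y, hyC⟩, hyt⟩, t, rfl⟩
  have hxb : x.1.1 ≤ b := hbK (Set.mem_image_of_mem _ hxK)
  exact absurd (hxt ▸ hxb : t ≤ b) (not_le.2 (hbs.trans hst))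

theorem pseudocompactSpace_prod : PseudocompactSpace (Omega × Omega0) := by
  intro f hf
  by_contra! h
  choose x hx using fun n : ℕ => h n
  obtain ⟨b, hb⟩ := bddAbove_range fun n => (x n).1
  have hK := (isCompact_Iic b).prod (isCompact_univ (X := Omega0))
  obtain ⟨M, hM⟩ := hK.exists_bound_of_continuousOn hf.continuousOn
  obtain ⟨n, hn⟩ := exists_nat_ge M
  have hxM := hM (x n) ⟨hb ⟨n, rfl⟩, trivial⟩
  rw [Real.norm_eq_abs] at hxM
  exact absurd (hx n) (not_lt.2 (hxM.trans hn))

theorem not_normalSpace_prod : ¬ NormalSpace (Omega × Omega0) := by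
  intro _
  have hD : IsClosed {x : Omega × Omega0 | incl x.1 = x.2} :=
    isClosed_eq (continuous_incl.comp continuous_fst) continuous_snd
  have hT : IsClosed {x : Omega × Omega0 | x.2 = top} := isClosed_eq continuous_snd continuous_const
  obtain ⟨U, V, hU, hV, hDU, hTV, hUV⟩ := normal_separation hD hT
    (Set.disjoint_left.2 fun x hx hx' => (incl_lt_top x.1).ne (Eq.trans hx hx'))
  have step : ∀ a : Omega, ∃ b : Omega, a < b ∧ (a, incl b) ∈ V := fun a => by
    have hnhds : (fun y => (a, y)) ⁻¹' V ∈ nhds top :=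
      (hV.preimage (by fun_prop)).mem_nhds (hTV rfl)
    obtain ⟨l, hl, hlV⟩ := exists_Ioc_subset_of_mem_nhds hnhds ⟨_, incl_lt_top a⟩
    obtain ⟨b, hb⟩ := exists_gt (max a ⟨l.1, Set.mem_Iio.2 hl⟩)
    rw [max_lt_iff] at hb
    exact ⟨b, hb.1, hlV ⟨hb.2, (incl_lt_top b).le⟩⟩
  choose g hg hgV using step
  let a : ℕ → Omega := fun n => g^[n] (Classical.arbitrary Omega)
  have ha : ∀ n, a (n + 1) = g (a n) := fun n => Function.iterate_succ_apply' g n _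
  obtain ⟨c, hc⟩ := exists_tendsto_of_monotone
    (monotone_nat_of_le_succ fun n => (ha n).symm ▸ (hg (a n)).le)
  have hlim : Filter.Tendsto (fun n => (a n, incl (a (n + 1)))) Filter.atTop (nhds (c, incl c)) :=
    hc.prodMk_nhds ((continuous_incl.tendsto c).comp (hc.comp (Filter.tendsto_add_atTop_nat 1)))
  obtain ⟨n, hn⟩ := (hlim.eventually_mem (hU.mem_nhds (hDU rfl))).exists
  exact Set.disjoint_left.1 hUV hn (ha n ▸ hgV (a n))

end Omega

/-- **`X = Ω × Ω₀` is CCS-normal but not Ps-normal.** -/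
theorem omega_prod_ccsNormal_not_psNormal :
    CCSNormal (Omega × Omega0) ∧ ¬ PsNormal (Omega × Omega0) := by
  have : Nonempty Omega0 := ⟨Omega.top⟩
  refine ⟨.of_subset_isCompact fun C hC => ?_,
    fun h => Omega.not_normalSpace_prod (h.normalSpace Omega.pseudocompactSpace_prod)⟩
  obtain ⟨b, hb⟩ := Omega.bddAbove_fst_image hC
  exact ⟨Set.Iic b ×ˢ Set.univ, (Omega.isCompact_Iic b).prod isCompact_univ,
    fun x hx => ⟨hb (Set.mem_image_of_mem _ hx), trivial⟩⟩
end

section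
/- If X is a CCS-normal Fréchet–Urysohn space and f : X → Y is a witness of CCS-normality (i.e., Y is a normal topological space, f is a bijection, and f|_C : C → f(C) is a homeomorphism for every cellular-compact subspace C of X), then f is continuous. -/
universe u

theorem IsCompact.cellularCompactSpace {X : Type u} [TopologicalSpace X] {C : Set X}
    (hC : IsCompact C) : CellularCompactSpace C := by
  have : CompactSpace C := isCompact_iff_compactSpace.mp hC
  intro 𝒰 _ hne _
  exact ⟨Set.univ, isCompact_univ, fun U hU => by simpa using hne U hU⟩

/-- **If `X` is a Fréchet–Urysohn space and `(Y, f)` is a witness of CCS-normality of `X`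
(`Y` normal, `f` a bijection restricting to a homeomorphism on every cellular-compact
subspace of `X`), then `f` is continuous.** -/
theorem ccsNormal_witness_continuous_of_frechetUrysohn
    {X Y : Type u} [TopologicalSpace X] [TopologicalSpace Y]
    [FrechetUrysohnSpace X] [NormalSpace Y]
    (f : X → Y) (hbij : Function.Bijective f)
    (hwit : ∀ C : Set X, CellularCompactSpace C →
      IsHomeomorph (Set.MapsTo.restrict f C (f '' C) (Set.mapsTo_image f C))) :
    Continuous f := by
  refine SeqContinuous.continuous fun u x hux => ?_
  have hcont : ContinuousOn f (insert x (Set.range u)) :=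
    continuousOn_iff_continuous_domRestrict.mpr <| continuous_subtype_val.comp
      (hwit _ hux.isCompact_insert_range.cellularCompactSpace).continuous
  refine (hcont x (Set.mem_insert x _)).tendsto.comp ?_
  exact tendsto_nhdsWithin_iff.mpr
    ⟨hux, .of_forall fun n => Set.mem_insert_of_mem x (Set.mem_range_self n)⟩
end

section
/- Let X = ⊕_{α∈Λ} X_α be the topological (disjoint) sum of a family of topological spaces and let C ⊆ X. Then C is cellular-compact (in the subspace topology) if and only if the set Λ₀ = {α ∈ Λ : C ∩ X_α ≠ ∅} is finite and C ∩ X_α is cellular-compact in X_α for each α ∈ Λ₀. -/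
universe u v

open Set Topology

lemma CellularCompactSpace.of_isClosedEmbedding_of_isOpenMap {Y : Type u} {Z : Type v}
    [TopologicalSpace Y] [TopologicalSpace Z] (hY : CellularCompactSpace Y) {f : Z → Y}
    (hf : IsClosedEmbedding f) (hfo : IsOpenMap f) : CellularCompactSpace Z := by
  intro 𝒱 ho hne hd
  obtain ⟨K, hK, hKm⟩ := hY (image f '' 𝒱)
    (by rintro _ ⟨V, hV, rfl⟩; exact hfo V (ho V hV))
    (by rintro _ ⟨V, hV, rfl⟩; exact (hne V hV).image f)
    (by
      rintro _ ⟨V, hV, rfl⟩ _ ⟨W, hW, rfl⟩ hVW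
      exact (disjoint_image_iff hf.injective).2 (hd hV hW (by rintro rfl; exact hVW rfl)))
  refine ⟨f ⁻¹' K, hf.isCompact_preimage hK, fun V hV ↦ ?_⟩
  obtain ⟨_, hxK, z, hz, rfl⟩ := hKm _ (mem_image_of_mem _ hV)
  exact ⟨z, hxK, hz⟩

lemma CellularCompactSpace.of_finite_cover {ι : Type*} {Y : Type u} {Z : ι → Type v}
    [TopologicalSpace Y] [∀ i, TopologicalSpace (Z i)] {s : Set ι} (hs : s.Finite)
    (hZ : ∀ i ∈ s, CellularCompactSpace (Z i)) {f : ∀ i, Z i → Y}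
    (hf : ∀ i, Continuous (f i)) (hcover : ∀ y, ∃ i ∈ s, y ∈ range (f i)) :
    CellularCompactSpace Y := by
  intro 𝒰 ho _ hd
  have key : ∀ i ∈ s, ∃ K : Set (Z i), IsCompact K ∧
      ∀ U ∈ 𝒰, (f i ⁻¹' U).Nonempty → (K ∩ f i ⁻¹' U).Nonempty := by
    intro i hi
    obtain ⟨K, hK, hKm⟩ := hZ i hi {V | V.Nonempty ∧ ∃ U ∈ 𝒰, f i ⁻¹' U = V}
      (by rintro _ ⟨-, U, hU, rfl⟩; exact (ho U hU).preimage (hf i))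
      (fun V hV ↦ hV.1)
      (by
        rintro _ ⟨-, U, hU, rfl⟩ _ ⟨-, W, hW, rfl⟩ hUW
        exact (hd hU hW (by rintro rfl; exact hUW rfl)).preimage (f i))
    exact ⟨K, hK, fun U hU hne ↦ hKm _ ⟨hne, U, hU, rfl⟩⟩
  choose! K hK hKm using key
  refine ⟨⋃ i ∈ s, f i '' K i, hs.isCompact_biUnion fun i hi ↦ (hK i hi).image (hf i),
    fun U hU ↦ ?_⟩
  obtain ⟨y, hy⟩ := ‹∀ U ∈ 𝒰, U.Nonempty› U hU
  obtain ⟨i, hi, z, rfl⟩ := hcover y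
  obtain ⟨w, hwK, hwU⟩ := hKm i hi U hU ⟨z, hy⟩
  exact ⟨f i w, mem_biUnion hi (mem_image_of_mem _ hwK), hwU⟩

lemma CellularCompactSpace.finite_range_of_isLocallyConstant {ι : Type*} {Y : Type u}
    [TopologicalSpace Y] (hY : CellularCompactSpace Y) {g : Y → ι} (hg : IsLocallyConstant g) :
    (range g).Finite := by
  obtain ⟨K, hK, hKm⟩ := hY (range fun y ↦ g ⁻¹' {g y})
    (by rintro _ ⟨y, rfl⟩; exact hg {g y})
    (by rintro _ ⟨y, rfl⟩; exact ⟨y, rfl⟩)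
    (by
      rintro _ ⟨y, rfl⟩ _ ⟨z, rfl⟩ hyz
      refine Disjoint.preimage g (disjoint_singleton.2 fun h ↦ hyz ?_)
      simp only [h])
  let _ : TopologicalSpace ι := ⊥
  have : DiscreteTopology ι := ⟨rfl⟩
  refine (hK.image hg.continuous).finite_of_discrete.subset ?_
  rintro _ ⟨y, rfl⟩
  obtain ⟨x, hxK, hx⟩ := hKm _ (mem_range_self y)
  exact ⟨x, hxK, hx⟩

lemma isLocallyConstant_sigma_fst {Λ : Type u} {X : Λ → Type v} [∀ α, TopologicalSpace (X α)] :
    IsLocallyConstant (Sigma.fst : (Σ α, X α) → Λ) := fun s ↦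
  isOpen_sigma_iff.2 fun α ↦ isOpen_const (p := α ∈ s)

/-- **Cellular-compact subsets of a topological sum**: a subset `C` of the topological sum
`⊕_{α∈Λ} X_α` is cellular-compact iff `Λ₀ = {α : C ∩ X_α ≠ ∅}` is finite and `C ∩ X_α` is
cellular-compact in `X_α` for every `α ∈ Λ₀`. -/
theorem cellularCompact_sigma_iff {Λ : Type u} {X : Λ → Type v}
    [∀ α, TopologicalSpace (X α)] (C : Set (Σ α, X α)) :
    CellularCompactSpace C ↔
      ({α : Λ | (Sigma.mk α ⁻¹' C).Nonempty}.Finite ∧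
        ∀ α ∈ {α : Λ | (Sigma.mk α ⁻¹' C).Nonempty},
          CellularCompactSpace (Sigma.mk α ⁻¹' C)) := by
  constructor
  · refine fun hC ↦ ⟨?_, fun α _ ↦ hC.of_isClosedEmbedding_of_isOpenMap
      (IsClosedEmbedding.sigmaMk.restrictPreimage C)
      (IsOpenEmbedding.sigmaMk.restrictPreimage C).isOpenMap⟩
    refine (hC.finite_range_of_isLocallyConstant
      (isLocallyConstant_sigma_fst.comp_continuous continuous_subtype_val)).subset ?_
    rintro α ⟨x, hx⟩
    exact ⟨⟨⟨α, x⟩, hx⟩, rfl⟩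
  · rintro ⟨hfin, hC⟩
    refine CellularCompactSpace.of_finite_cover hfin hC
      (f := fun α ↦ C.restrictPreimage (Sigma.mk α))
      (fun α ↦ continuous_sigmaMk.restrictPreimage) ?_
    rintro ⟨⟨α, x⟩, hx⟩
    exact ⟨α, ⟨x, hx⟩, ⟨x, hx⟩, rfl⟩
end
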